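/- Let O = k[[ε]], L = Oⁿ, and A ∈ Mₙ(O) with det A ≠ 0 and d = val(det A). For a nonnegative integer N ≥ d, let A_N : L/εᴺL → L/εᴺL be the map induced by A. Then the kernel of A_N has k-dimension d and is contained in the subspace εᴺ⁻ᵈL/εᴺL of L/εᴺL. -/

import Mathlib

open PowerSeries

/-- The `k`-submodule `εᴺ·L` of `L = Oⁿ`, where `O = k[[ε]]`. -/
noncomputable def epsPowSubmodule (k : Type*) [Field k] (n N : ℕ) :
    Submodule k (Fin n → PowerSeries k) :=
  LinearMap.range
    ((((X : PowerSeries k) ^ N) •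
        (LinearMap.id : (Fin n → PowerSeries k) →ₗ[PowerSeries k]
          (Fin n → PowerSeries k))).restrictScalars k)

/-- The `k`-linear endomorphism of `L/εᴺL` induced by a matrix `A` over `O = k[[ε]]`. -/
noncomputable def matrixModEps {k : Type*} [Field k] {n : ℕ}
    (A : Matrix (Fin n) (Fin n) (PowerSeries k)) (N : ℕ) :
    ((Fin n → PowerSeries k) ⧸ epsPowSubmodule k n N) →ₗ[k]
      ((Fin n → PowerSeries k) ⧸ epsPowSubmodule k n N) :=
  Submodule.mapQ (epsPowSubmodule k n N) (epsPowSubmodule k n N)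
    (A.mulVecLin.restrictScalars k)
    (by
      rintro v ⟨u, rfl⟩
      exact ⟨A.mulVec u, by
        simp [Matrix.mulVec_smul]⟩)

/-- The determinant of an injective endomorphism of a finite free module over a principal ideal
domain is associated to the product of the Smith coefficients of its range. -/
theorem LinearMap.associated_det_prod_smithNormalFormCoeffs {R M ι : Type*} [CommRing R]
    [IsDomain R] [IsPrincipalIdealRing R] [AddCommGroup M] [Module R M] [Fintype ι]
    (b : Module.Basis ι R M) (f : M →ₗ[R] M) (hf : Function.Injective f)
    (h : Module.finrank R (LinearMap.range f) = Module.finrank R M) :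
    Associated (LinearMap.det f) (∏ i, Submodule.smithNormalFormCoeffs b h i) := by
  classical
  let b' := Submodule.smithNormalFormTopBasis b h
  let ab := Submodule.smithNormalFormBotBasis b h
  let e : M ≃ₗ[R] M := (b'.equiv ab (Equiv.refl _)).trans (LinearEquiv.ofInjective f hf).symm
  rw [← Matrix.det_diagonal, ← LinearMap.det_toLin b']
  refine (LinearMap.associated_det_of_eq_comp e _ _ fun x => ?_).symm
  have hfe : f (e x) = (b'.equiv ab (Equiv.refl _) x : M) := by
    rw [← LinearEquiv.ofInjective_apply (h := hf)]
    simp [e]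
  rw [hfe]
  have key : Matrix.toLin b' b' (Matrix.diagonal (Submodule.smithNormalFormCoeffs b h)) =
      (Submodule.subtype _).comp (b'.equiv ab (Equiv.refl _)).toLinearMap := by
    refine b'.ext fun i => ?_
    simp only [LinearMap.comp_apply, LinearEquiv.coe_coe, Module.Basis.equiv_apply,
      Submodule.subtype_apply, Equiv.refl_apply, Matrix.toLin_self]
    rw [Finset.sum_eq_single i]
    · simp [ab, b']
    · intro j _ hj
      simp [Matrix.diagonal_apply_ne _ hj]
    · simp
  exact LinearMap.congr_fun key x

namespace PowerSeries

variable {k : Type*} [Field k]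

/-- A nonzero power series over a field is associated to `X` raised to its order. -/
theorem associated_X_pow_of_order_eq {a : PowerSeries k} {d : ℕ} (ha : a.order = d) :
    Associated ((X : PowerSeries k) ^ d) a := by
  have h0 : a ≠ 0 := by
    rintro rfl
    simp at ha
  obtain ⟨u, hu⟩ := isUnit_divided_by_X_pow_order h0
  refine ⟨u, ?_⟩
  rw [hu]
  simpa [ha] using X_pow_order_mul_divXPowOrder (f := a)

/-- The quotient of `k⟦X⟧` by a power series of order `d` is isomorphic to `k ^ d`. -/
noncomputable def quotientSpanSingletonEquiv {a : PowerSeries k} {d : ℕ} (ha : a.order = d) :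
    (PowerSeries k ⧸ Ideal.span {a}) ≃ₗ[k] (Fin d → k) :=
  (Submodule.Quotient.restrictScalarsEquiv k (Ideal.span {a})).symm.trans <|
    (Submodule.quotEquivOfEq _ (LinearMap.ker (LinearMap.pi fun i : Fin d => coeff (R := k) i)) (by
      ext f
      rw [Submodule.restrictScalars_mem, Ideal.mem_span_singleton,
        ← (associated_X_pow_of_order_eq ha).dvd_iff_dvd_left, X_pow_dvd_iff, LinearMap.mem_ker,
        funext_iff]
      exact ⟨fun h i => h i i.2, fun h i hi => h ⟨i, hi⟩⟩)).trans <|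
    LinearMap.quotKerEquivOfSurjective _ fun g =>
      ⟨mk fun j => if h : j < d then g ⟨j, h⟩ else 0, by ext i; simp⟩

/-- The cokernel of a square matrix over `k⟦X⟧` whose determinant has order `d` has
`k`-dimension `d`. -/
theorem finrank_quotient_range_mulVecLin {n : Type*} [Fintype n] [DecidableEq n]
    (A : Matrix n n (PowerSeries k)) {d : ℕ} (hd : A.det.order = d) :
    Module.finrank k ((n → PowerSeries k) ⧸ LinearMap.range A.mulVecLin) = d := by
  have hA : A.det ≠ 0 := by
    intro h
    simp [h] at hd
  have hinj : Function.Injective A.mulVecLin := Matrix.mulVec_injective_of_det_ne_zero hA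
  have h := LinearMap.finrank_range_of_inj hinj
  let b := Pi.basisFun (PowerSeries k) n
  have hassoc := LinearMap.associated_det_prod_smithNormalFormCoeffs b A.mulVecLin hinj h
  have hdet : LinearMap.det A.mulVecLin = A.det := by
    rw [← Matrix.toLin'_apply', LinearMap.det_toLin']
  rw [hdet] at hassoc
  have hne := Submodule.smithNormalFormCoeffs_ne_zero b h
  have hord (i : n) : ∃ m : ℕ, (Submodule.smithNormalFormCoeffs b h i).order = m :=
    ⟨_, (ENat.natCast_toNat (order_eq_top.not.2 (hne i))).symm⟩
  choose m hm using hord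
  have hsum : ∑ i, m i = d := by
    obtain ⟨u, hu⟩ := hassoc
    have := congrArg order hu
    rw [order_mul, order_zero_of_unit u.isUnit, order_prod, hd, add_zero] at this
    simp only [hm] at this
    exact_mod_cast this.symm
  have (i : n) := Module.Finite.equiv (quotientSpanSingletonEquiv (hm i)).symm
  rw [Submodule.finrank_quotient_eq_sum k b h, ← hsum]
  exact Finset.sum_congr rfl fun i _ => by
    rw [(quotientSpanSingletonEquiv (hm i)).finrank_eq, Module.finrank_fin_fun]

end PowerSeries

theorem mem_epsPowSubmodule {k : Type*} [Field k] {n N : ℕ} {v : Fin n → PowerSeries k} :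
    v ∈ epsPowSubmodule k n N ↔ ∃ u, (X : PowerSeries k) ^ N • u = v :=
  Iff.rfl

/-- If `det A` has order `d`, then `A` has a quasi-inverse `B` with `A B = B A = εᵈ`. -/
theorem Matrix.exists_mul_eq_X_pow_smul_one {k n : Type*} [Field k] [Fintype n] [DecidableEq n]
    (A : Matrix n n (PowerSeries k)) {d : ℕ} (hd : A.det.order = d) :
    ∃ B : Matrix n n (PowerSeries k),
      A * B = (X : PowerSeries k) ^ d • 1 ∧ B * A = (X : PowerSeries k) ^ d • 1 := by
  obtain ⟨u, hu⟩ := (PowerSeries.associated_X_pow_of_order_eq hd).symm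
  refine ⟨(u : PowerSeries k) • A.adjugate, ?_, ?_⟩
  · rw [Matrix.mul_smul, Matrix.mul_adjugate, smul_smul, mul_comm, hu]
  · rw [Matrix.smul_mul, Matrix.adjugate_mul, smul_smul, mul_comm, hu]

/-- Let `O = k[[ε]]`, `L = Oⁿ`, `A ∈ Mₙ(O)` with `det A ≠ 0` and `d = val(det A)`.  For `N ≥ d`,
the kernel of the induced map `A_N : L/εᴺL → L/εᴺL` has `k`-dimension `d` and is contained in
the subspace `εᴺ⁻ᵈL/εᴺL`. -/
theorem finrank_ker_matrixModEps {k : Type*} [Field k] {n : ℕ}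
    (A : Matrix (Fin n) (Fin n) (PowerSeries k)) (hA : A.det ≠ 0) (d : ℕ)
    (hd : A.det.order = d) (N : ℕ) (hN : d ≤ N) :
    Module.finrank k (LinearMap.ker (matrixModEps A N)) = d ∧
      LinearMap.ker (matrixModEps A N) ≤
        Submodule.map (epsPowSubmodule k n N).mkQ (epsPowSubmodule k n (N - d)) := by
  obtain ⟨B, hAB, hBA⟩ := A.exists_mul_eq_X_pow_smul_one hd
  have hABv (v : Fin n → PowerSeries k) : A.mulVec (B.mulVec v) = (X : PowerSeries k) ^ d • v := by
    rw [Matrix.mulVec_mulVec, hAB, Matrix.smul_mulVec, Matrix.one_mulVec]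
  have hBAv (v : Fin n → PowerSeries k) : B.mulVec (A.mulVec v) = (X : PowerSeries k) ^ d • v := by
    rw [Matrix.mulVec_mulVec, hBA, Matrix.smul_mulVec, Matrix.one_mulVec]
  have hX (m : ℕ) : (X : PowerSeries k) ^ m ≠ 0 := pow_ne_zero _ X_ne_zero
  have hinj : Function.Injective B.mulVec := fun v w hvw => by
    have := congrArg A.mulVec hvw
    rw [hABv, hABv] at this
    exact smul_right_injective _ (hX d) this
  have hpow : (X : PowerSeries k) ^ (N - d) * X ^ d = X ^ N := by
    rw [← pow_add, Nat.sub_add_cancel hN]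
  let φ : (Fin n → PowerSeries k) →ₗ[k] ((Fin n → PowerSeries k) ⧸ epsPowSubmodule k n N) :=
    (epsPowSubmodule k n N).mkQ ∘ₗ
      ((((X : PowerSeries k) ^ (N - d)) • B.mulVecLin).restrictScalars k)
  have hφ (u : Fin n → PowerSeries k) : φ u =
      (epsPowSubmodule k n N).mkQ ((X : PowerSeries k) ^ (N - d) • B.mulVec u) := rfl
  have hrange : LinearMap.range φ = LinearMap.ker (matrixModEps A N) := by
    ext q
    obtain ⟨v, rfl⟩ := Submodule.mkQ_surjective _ q
    have hker : (epsPowSubmodule k n N).mkQ v ∈ LinearMap.ker (matrixModEps A N) ↔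
        A.mulVec v ∈ epsPowSubmodule k n N := by
      rw [LinearMap.mem_ker]
      exact Submodule.Quotient.mk_eq_zero _
    rw [hker, mem_epsPowSubmodule]
    constructor
    · rintro ⟨u, hu⟩
      rw [hφ, Submodule.mkQ_apply, Submodule.mkQ_apply, Submodule.Quotient.eq,
        mem_epsPowSubmodule] at hu
      obtain ⟨w, hw⟩ := hu
      refine ⟨u - A.mulVec w, ?_⟩
      rw [eq_sub_iff_add_eq, ← eq_sub_iff_add_eq'] at hw
      rw [hw, Matrix.mulVec_sub, Matrix.mulVec_smul, Matrix.mulVec_smul, hABv, smul_smul, hpow,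
        smul_sub]
    · rintro ⟨u, hu⟩
      refine ⟨u, ?_⟩
      rw [hφ]
      congr 1
      refine smul_right_injective _ (hX d) ?_
      change (X : PowerSeries k) ^ d • _ = (X : PowerSeries k) ^ d • v
      rw [smul_smul, mul_comm, hpow, ← Matrix.mulVec_smul, hu, hBAv]
  have hkerφ : LinearMap.ker φ = (LinearMap.range A.mulVecLin).restrictScalars k := by
    ext u
    rw [LinearMap.mem_ker, hφ, Submodule.mkQ_apply, Submodule.Quotient.mk_eq_zero,
      mem_epsPowSubmodule, Submodule.restrictScalars_mem, LinearMap.mem_range]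
    refine exists_congr fun w => ?_
    rw [Matrix.mulVecLin_apply, ← hpow, mul_smul, (smul_right_injective _ (hX (N - d))).eq_iff,
      ← hBAv, hinj.eq_iff]
  rw [← hrange]
  constructor
  · rw [← φ.quotKerEquivRange.finrank_eq, (Submodule.quotEquivOfEq _ _ hkerφ).finrank_eq,
      (Submodule.Quotient.restrictScalarsEquiv k _).finrank_eq,
      PowerSeries.finrank_quotient_range_mulVecLin A hd]
  · rintro _ ⟨u, rfl⟩
    exact ⟨_, ⟨B.mulVec u, rfl⟩, rfl⟩
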